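/- arXiv:2405.00898 — 2 statements merged into one kernel-verified Lean document; each statement's English description precedes it below -/
import Mathlib

section
/- For every n ≥ 3 and every real root λ̄ of a_{n−1}, the following commutation relations hold: [X̂, X] = 2λ̄·Ẑ, [Ŷ, X] = −4·Ẑ, [Ẑ, X] = 4·Ŷ, [X̂, Z^0] = −4·Ẑ, [Ŷ, Z^0] = 2λ̄·Ẑ, and [Ẑ, Z^0] = 4·X̂. -/
namespace Ising

noncomputable section

open Matrix

attribute [local instance 100] LieRing.ofAssociativeRing

/-- We model `2^n × 2^n` complex matrices as matrices indexed by `Fin n → Fin 2`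
(the standard index type for an `n`-fold tensor product of qubits). -/
abbrev M (n : ℕ) := Matrix (Fin n → Fin 2) (Fin n → Fin 2) ℂ

/-- The Pauli matrix σx. -/
def sx : Matrix (Fin 2) (Fin 2) ℂ := !![0, 1; 1, 0]
/-- The Pauli matrix σy. -/
def sy : Matrix (Fin 2) (Fin 2) ℂ := !![0, Complex.I; -Complex.I, 0]
/-- The Pauli matrix σz. -/
def sz : Matrix (Fin 2) (Fin 2) ℂ := !![1, 0; 0, -1]

/-- The `n`-fold Kronecker product of the `2 × 2` matrices `f 0, …, f (n-1)`. -/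
def kron {n : ℕ} (f : Fin n → Matrix (Fin 2) (Fin 2) ℂ) : M n :=
  fun x y => ∏ j, f j (x j) (y j)

/-- The matrix `σ` placed in the `j`-th tensor factor, identity elsewhere (`σ^j`). -/
def pauliAt (n : ℕ) (σ : Matrix (Fin 2) (Fin 2) ℂ) (j : Fin n) : M n :=
  kron fun i => if i = j then σ else 1

/-- The permutation matrix implementing the cyclic shift of the `n` tensor factors. -/
def P (n : ℕ) : M n :=
  fun x y => if x = (fun i => y (finRotate n i)) then 1 else 0

/-- The symmetrizer `C(A) = ∑_{k=0}^{n-1} Pᵏ A (Pᵏ)⁻¹` over the cyclic group `C_n`. -/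
def symmC {n : ℕ} (A : M n) : M n :=
  ∑ k ∈ Finset.range n, P n ^ k * A * (P n ^ k)⁻¹

/-- The Pauli string `a ⊗ σx^{⊗j} ⊗ b ⊗ 1^{⊗(n-j-2)}`. -/
def str (n : ℕ) (a b : Matrix (Fin 2) (Fin 2) ℂ) (j : ℕ) : M n :=
  kron fun i => if (i : ℕ) = 0 then a else if (i : ℕ) = j + 1 then b
    else if (i : ℕ) ≤ j then sx else 1

/-- `Y^j := i C(σy ⊗ σx^{⊗j} ⊗ σy ⊗ 1^{⊗(n-j-2)})`. -/
def Y (n j : ℕ) : M n := Complex.I • symmC (str n sy sy j)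
/-- `Z^j := i C(σz ⊗ σx^{⊗j} ⊗ σz ⊗ 1^{⊗(n-j-2)})`. -/
def Z (n j : ℕ) : M n := Complex.I • symmC (str n sz sz j)
/-- `YZ^j := i C(σz ⊗ σx^{⊗j} ⊗ σy ⊗ 1^{⊗(n-j-2)}) + i C(σy ⊗ σx^{⊗j} ⊗ σz ⊗ 1^{⊗(n-j-2)})`. -/
def YZ (n j : ℕ) : M n :=
  Complex.I • symmC (str n sz sy j) + Complex.I • symmC (str n sy sz j)
/-- `X := i C(σx ⊗ 1^{⊗(n-1)})`. -/
def X (n : ℕ) : M n :=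
  Complex.I • symmC (kron fun i : Fin n => if (i : ℕ) = 0 then sx else 1)
/-- `XX := i C(σx^{⊗(n-1)} ⊗ 1)`. -/
def XX (n : ℕ) : M n :=
  Complex.I • symmC (kron fun i : Fin n => if (i : ℕ) = n - 1 then 1 else sx)

/-- `H0 = ∑_{j=1}^{n-1} σz^j σz^{j+1} + σz^n σz^1` (cyclically next neighbours). -/
def H0 (n : ℕ) : M n := ∑ j : Fin n, pauliAt n sz j * pauliAt n sz (finRotate n j)
/-- `H1 = ∑_{j=1}^{n} σx^j`. -/
def H1 (n : ℕ) : M n := ∑ j : Fin n, pauliAt n sx j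

/-- The dynamical Lie algebra: the smallest real Lie subalgebra of the `2^n × 2^n`
complex matrices (with the commutator bracket) containing `i•H0` and `i•H1`. -/
def DLA (n : ℕ) : LieSubalgebra ℝ (M n) :=
  LieSubalgebra.lieSpan ℝ (M n) {Complex.I • H0 n, Complex.I • H1 n}

/-- The polynomials `a_k(λ)`, defined by `a₋₁ = 0`, `a₀ = 1`, `a_k = λ a_{k-1} - a_{k-2}`
(so `a 1 = λ·a₀ - a₋₁ = λ`). -/
def aSeq (lam : ℝ) : ℕ → ℝ
  | 0 => 1
  | 1 => lam
  | k + 2 => lam * aSeq lam (k + 1) - aSeq lam k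

/-- `X̂ = a₀(X + Z¹) + a_{n-2}(λ̄)(XX - Y^{n-3}) + ∑_{k=1}^{n-3} a_k(λ̄)(Z^{k+1} - Y^{k-1})`. -/
def Xhat (n : ℕ) (lam : ℝ) : M n :=
  (X n + Z n 1) + aSeq lam (n - 2) • (XX n - Y n (n - 3)) +
    ∑ k ∈ Finset.Icc 1 (n - 3), aSeq lam k • (Z n (k + 1) - Y n (k - 1))

/-- `Ŷ = ∑_{k=0}^{n-2} a_k(λ̄)(Y^k - Z^k)`. -/
def Yhat (n : ℕ) (lam : ℝ) : M n :=
  ∑ k ∈ Finset.range (n - 1), aSeq lam k • (Y n k - Z n k)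

/-- `Ẑ = ∑_{k=0}^{n-2} a_k(λ̄) YZ^k`. -/
def Zhat (n : ℕ) (lam : ℝ) : M n :=
  ∑ k ∈ Finset.range (n - 1), aSeq lam k • YZ n k

/-- `I_λ̄ = span_ℝ {X̂, Ŷ, Ẑ}`. -/
def Ideal (n : ℕ) (lam : ℝ) : Submodule ℝ (M n) :=
  Submodule.span ℝ {Xhat n lam, Yhat n lam, Zhat n lam}

/-- The cyclic sum of shifts of a Kronecker product. -/
def C {m : ℕ} (f : Fin (m+3) → Matrix (Fin 2) (Fin 2) ℂ) : M (m+3) :=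
  ∑ l : Fin (m+3), kron (fun i => f (i + l))

lemma C_shift {m : ℕ} (f : Fin (m+3) → Matrix (Fin 2) (Fin 2) ℂ) (d : Fin (m+3)) :
    C (fun i => f (i + d)) = C f := by
  unfold C
  rw [← Equiv.sum_comp (Equiv.addRight d) (fun l => kron (fun i => f (i + l)))]
  refine Finset.sum_congr rfl fun l _ => ?_
  simp only [Equiv.coe_addRight, add_assoc]

lemma P_mul_kron {m : ℕ} (f : Fin (m+3) → Matrix (Fin 2) (Fin 2) ℂ) :
    P (m+3) * kron f = kron (fun i => f (i + 1)) * P (m+3) := by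
  ext x z
  simp only [Matrix.mul_apply, P, mul_ite, mul_one, mul_zero, ite_mul, one_mul, zero_mul]
  have h1 : ∀ y : Fin (m+3) → Fin 2, (x = fun i => y (finRotate (m+3) i)) ↔
      ((fun i => x ((finRotate (m+3)).symm i)) = y) := by
    intro y
    constructor
    · rintro rfl; funext i; simp
    · rintro rfl; funext i; simp
  simp only [h1]
  simp only [Finset.sum_ite_eq, Finset.sum_ite_eq', Finset.mem_univ, if_true, kron]
  rw [← Equiv.prod_comp (finRotate (m+3))]
  refine Finset.prod_congr rfl fun i _ => ?_
  simp

lemma P_unit (m : ℕ) : IsUnit (P (m+3)).det := by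
  have h : P (m+3) * (P (m+3))ᵀ = 1 := by
    ext x z
    simp only [Matrix.mul_apply, P, Matrix.transpose_apply, mul_ite, mul_one, mul_zero]
    have h1 : ∀ x y : Fin (m+3) → Fin 2, (x = fun i => y (finRotate (m+3) i)) ↔
        ((fun i => x ((finRotate (m+3)).symm i)) = y) := by
      intro x y
      constructor
      · rintro rfl; funext i; simp
      · rintro rfl; funext i; simp
    simp only [h1]
    simp only [Finset.sum_ite_eq, Finset.mem_univ, if_true, Matrix.one_apply]
    congr 1
    rw [eq_iff_iff]
    constructor
    · intro h; funext i
      have := congrFun h (finRotate (m+3) i)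
      simpa using this
    · rintro rfl; rfl
  exact Matrix.isUnit_det_of_right_inverse h

lemma Ppow_mul_kron {m : ℕ} (f : Fin (m+3) → Matrix (Fin 2) (Fin 2) ℂ) (k : ℕ) :
    P (m+3) ^ k * kron f = kron (fun i => f (i + k • (1 : Fin (m+3)))) * P (m+3) ^ k := by
  induction k with
  | zero => simp
  | succ k ih =>
    rw [pow_succ', mul_assoc, ih, ← mul_assoc, P_mul_kron, mul_assoc]
    congr 2
    funext i
    congr 1
    rw [succ_nsmul', add_assoc]

lemma val_nsmul_one {m : ℕ} (k : Fin (m+3)) : (k : ℕ) • (1 : Fin (m+3)) = k := by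
  have h : ∀ j : ℕ, (((j • (1 : Fin (m+3))) : Fin (m+3)) : ℕ) = j % (m+3) := by
    intro j
    induction j with
    | zero => simp
    | succ j ih => rw [succ_nsmul, Fin.val_add, ih]; simp [Nat.add_mod]
  apply Fin.ext
  rw [h, Nat.mod_eq_of_lt k.2]

lemma symmC_kron {m : ℕ} (f : Fin (m+3) → Matrix (Fin 2) (Fin 2) ℂ) :
    symmC (kron f) = C f := by
  unfold symmC C
  rw [Finset.sum_range]
  refine Finset.sum_congr rfl fun k _ => ?_
  rw [Ppow_mul_kron, mul_assoc, Matrix.mul_nonsing_inv, mul_one, val_nsmul_one]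
  rw [Matrix.det_pow]
  exact (P_unit m).pow _

lemma kron_mul {n : ℕ} (f g : Fin n → Matrix (Fin 2) (Fin 2) ℂ) :
    kron f * kron g = kron (fun i => f i * g i) := by
  ext x z
  simp only [Matrix.mul_apply, kron]
  rw [Finset.prod_univ_sum]
  rw [Fintype.piFinset_univ]
  refine Finset.sum_congr rfl fun y _ => ?_
  rw [Finset.prod_mul_distrib]

lemma kron_smul {n : ℕ} (c : Fin n → ℂ) (f : Fin n → Matrix (Fin 2) (Fin 2) ℂ) :
    kron (fun i => c i • f i) = (∏ i, c i) • kron f := by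
  ext x z
  simp [kron, Finset.prod_mul_distrib]

lemma C_smul {m : ℕ} (c : Fin (m+3) → ℂ) (f : Fin (m+3) → Matrix (Fin 2) (Fin 2) ℂ) :
    C (fun i => c i • f i) = (∏ i, c i) • C f := by
  unfold C
  rw [Finset.smul_sum]
  refine Finset.sum_congr rfl fun l _ => ?_
  rw [kron_smul (fun i => c (i + l)) (fun i => f (i + l))]
  congr 1
  exact Equiv.prod_comp (Equiv.addRight l) c

lemma C_one_site {m : ℕ} (p : Fin (m+3)) (c : ℂ) (h g : Fin (m+3) → Matrix (Fin 2) (Fin 2) ℂ)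
    (hp : h p = c • g p) (hi : ∀ i, i ≠ p → h i = g i) : C h = c • C g := by
  have : h = fun i => (if i = p then c else 1) • g i := by
    funext i
    by_cases e : i = p
    · subst e; simp [hp]
    · simp [e, hi i e]
  rw [this, C_smul]
  simp

lemma C_comm {m : ℕ} (f g : Fin (m+3) → Matrix (Fin 2) (Fin 2) ℂ) (e : Fin (m+3) → ℂ)
    (hs : ∀ p l, kron (fun i => g (i + l - p)) * kron (fun i => f (i + l)) 
      = e p • kron (fun i => f (i+l) * g (i + l - p))) :
    C f * C g - C g * C f = ∑ p, (1 - e p) • C (fun i => f i * g (i - p)) := by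
  have h1 : ∀ l, C g = ∑ p, kron (fun i => g (i + l - p)) := by
    intro l
    unfold C
    rw [← Equiv.sum_comp (Equiv.subLeft l)]
    refine Finset.sum_congr rfl fun p _ => ?_
    simp [add_sub_assoc]
  have h2 : C f * C g = ∑ p, C (fun i => f i * g (i - p)) := by
    conv_lhs => rw [C, Finset.sum_mul]
    simp only [C]
    rw [Finset.sum_comm]
    refine Finset.sum_congr rfl fun l _ => ?_
    change _ * C g = _
    rw [h1 l, Finset.mul_sum]
    refine Finset.sum_congr rfl fun p _ => ?_
    rw [kron_mul]
  have h3 : C g * C f = ∑ p, e p • C (fun i => f i * g (i - p)) := by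
    conv_lhs => rw [C.eq_def f, Finset.mul_sum]
    simp only [C.eq_def (fun i => f i * g (i - _)), Finset.smul_sum]
    rw [Finset.sum_comm]
    refine Finset.sum_congr rfl fun l _ => ?_
    rw [h1 l, Finset.sum_mul]
    refine Finset.sum_congr rfl fun p _ => ?_
    rw [hs]
  rw [h2, h3, ← Finset.sum_sub_distrib]
  refine Finset.sum_congr rfl fun p _ => ?_
  rw [sub_smul, one_smul]

lemma C_comm' {m : ℕ} (f g : Fin (m+3) → Matrix (Fin 2) (Fin 2) ℂ)
    (e : Fin (m+3) → Fin (m+3) → ℂ)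
    (he : ∀ p i, g (i - p) * f i = e p i • (f i * g (i - p))) :
    C f * C g - C g * C f = ∑ p, (1 - ∏ i, e p i) • C (fun i => f i * g (i - p)) := by
  have key : ∀ p l, kron (fun i => g (i + l - p)) * kron (fun i => f (i + l)) 
      = (∏ i, e p i) • kron (fun i => f (i+l) * g (i + l - p)) := by
    intro p l
    rw [kron_mul]
    simp only [he]
    rw [kron_smul (fun i => e p (i + l))]
    congr 1
    exact Equiv.prod_comp (Equiv.addRight l) (e p)
  exact C_comm f g _ key

lemma val_add_one {m : ℕ} (i : Fin (m+3)) :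
    ((i + 1 : Fin (m+3)) : ℕ) = if (i : ℕ) = m + 2 then 0 else (i : ℕ) + 1 := by
  rw [Fin.val_add, Fin.val_one]
  split_ifs with h
  · simp [h]
  · exact Nat.mod_eq_of_lt (by omega)

/-- The site function of a Pauli string. -/
def sf {m : ℕ} (a b : Matrix (Fin 2) (Fin 2) ℂ) (j : ℕ) (i : Fin (m+3)) :
    Matrix (Fin 2) (Fin 2) ℂ :=
  if (i : ℕ) = 0 then a else if (i : ℕ) = j + 1 then b else if (i : ℕ) ≤ j then sx else 1

/-- Site function for X. -/
def xf {m : ℕ} (i : Fin (m+3)) : Matrix (Fin 2) (Fin 2) ℂ := if (i : ℕ) = 0 then sx else 1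

/-- Site function for XX. -/
def xxf {m : ℕ} (i : Fin (m+3)) : Matrix (Fin 2) (Fin 2) ℂ := if (i : ℕ) = m + 2 then 1 else sx

/-- Bond function. -/
def bf {m : ℕ} (p i : Fin (m+3)) : Matrix (Fin 2) (Fin 2) ℂ :=
  if i = p then sz else if i = p + 1 then sz else 1

lemma zx : sz * sx = (-Complex.I) • sy := by ext i j; fin_cases i <;> fin_cases j <;> simp [sz, sx, sy]
lemma xz : sx * sz = Complex.I • sy := by ext i j; fin_cases i <;> fin_cases j <;> simp [sz, sx, sy]
lemma zy : sz * sy = Complex.I • sx := by ext i j; fin_cases i <;> fin_cases j <;> simp [sz, sx, sy]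
lemma yz : sy * sz = (-Complex.I) • sx := by ext i j; fin_cases i <;> fin_cases j <;> simp [sz, sx, sy]
lemma yx : sy * sx = Complex.I • sz := by ext i j; fin_cases i <;> fin_cases j <;> simp [sz, sx, sy]
lemma xy : sx * sy = (-Complex.I) • sz := by ext i j; fin_cases i <;> fin_cases j <;> simp [sz, sx, sy]
lemma zz : sz * sz = 1 := by ext i j; fin_cases i <;> fin_cases j <;> simp [sz]

lemma bond_eq {m : ℕ} (p i : Fin (m+3)) : sf sz sz 0 (i - p) = bf p i := by
  unfold sf bf
  have h0 : ((i - p : Fin (m+3)) : ℕ) = 0 ↔ i = p := by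
    rw [← sub_eq_zero (a := i), Fin.ext_iff]; simp
  have h1 : ((i - p : Fin (m+3)) : ℕ) = 0 + 1 ↔ i = p + 1 := by
    rw [← sub_eq_iff_eq_add', Fin.ext_iff]; simp
  simp only [h0, h1, Nat.le_zero]
  split_ifs <;> rfl

lemma ne_add_one {m : ℕ} (p : Fin (m+3)) : p + 1 ≠ p := by
  intro h
  have := congrArg Fin.val h
  rw [val_add_one] at this
  split_ifs at this <;> omega

lemma bond_comm {m : ℕ} (f : Fin (m+3) → Matrix (Fin 2) (Fin 2) ℂ) (e : Fin (m+3) → ℂ)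
    (he : ∀ i, sz * f i = e i • (f i * sz)) :
    C f * C (sf sz sz 0) - C (sf sz sz 0) * C f =
      ∑ p, (1 - e p * e (p + 1)) • C (fun i => f i * bf p i) := by
  rw [C_comm' f (sf sz sz 0) (fun p i => if i = p then e i else if i = p + 1 then e i else 1)]
  · refine Finset.sum_congr rfl fun p _ => ?_
    simp only [bond_eq]
    congr 2
    rw [Finset.prod_ite, Finset.prod_ite]
    simp only [Finset.prod_const_one, mul_one, Finset.filter_filter]
    congr 1
    · rw [Finset.filter_eq' Finset.univ p]; simp
    · have : (Finset.univ.filter (fun a : Fin (m+3) => ¬ a = p ∧ a = p + 1)) = {p + 1} := by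
        ext a
        simp only [Finset.mem_filter, Finset.mem_univ, true_and, Finset.mem_singleton]
        constructor
        · exact fun h => h.2
        · rintro rfl; exact ⟨ne_add_one p, rfl⟩
      rw [this]; simp
  · intro p i
    rw [bond_eq, bf]
    split_ifs <;> simp [he]

lemma bond_comm_two {m : ℕ} (f : Fin (m+3) → Matrix (Fin 2) (Fin 2) ℂ) (e : Fin (m+3) → ℂ)
    (he : ∀ i, sz * f i = e i • (f i * sz)) (p q : Fin (m+3)) (hpq : p ≠ q)
    (hp : e p * e (p + 1) = -1) (hq : e q * e (q + 1) = -1)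
    (hr : ∀ r, r ≠ p → r ≠ q → e r * e (r + 1) = 1) :
    C f * C (sf sz sz 0) - C (sf sz sz 0) * C f =
      (2 : ℂ) • C (fun i => f i * bf p i) + (2 : ℂ) • C (fun i => f i * bf q i) := by
  rw [bond_comm f e he, Finset.sum_eq_add p q hpq]
  · rw [hp, hq]; norm_num
  · rintro r - ⟨h1, h2⟩
    rw [hr r h1 h2]; simp
  · simp
  · simp

lemma bond_comm_none {m : ℕ} (f : Fin (m+3) → Matrix (Fin 2) (Fin 2) ℂ) (e : Fin (m+3) → ℂ)
    (he : ∀ i, sz * f i = e i • (f i * sz)) 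
    (hr : ∀ r, e r * e (r + 1) = 1) :
    C f * C (sf sz sz 0) - C (sf sz sz 0) * C f = 0 := by
  rw [bond_comm f e he]
  refine Finset.sum_eq_zero fun r _ => ?_
  rw [hr r]; simp

/-- Sign function of a string. -/
def ef {m : ℕ} (a b : ℂ) (j : ℕ) (i : Fin (m+3)) : ℂ :=
  if (i : ℕ) = 0 then a else if (i : ℕ) = j + 1 then b else if (i : ℕ) ≤ j then -1 else 1

lemma sf_ef {m : ℕ} (a b : Matrix (Fin 2) (Fin 2) ℂ) (u v : ℂ) (j : ℕ)
    (ha : sz * a = u • (a * sz)) (hb : sz * b = v • (b * sz)) (i : Fin (m+3)) :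
    sz * sf a b j i = ef u v j i • (sf a b j i * sz) := by
  unfold sf ef
  split_ifs
  · exact ha
  · exact hb
  · rw [zx, xz]; simp
  · simp

lemma hz : sz * sz = (1 : ℂ) • (sz * sz) := by simp
lemma hy : sz * sy = (-1 : ℂ) • (sy * sz) := by rw [zy, yz]; simp

/-! Site values. -/
lemma C_eq_shift {m : ℕ} (p : Fin (m+3)) (c : ℂ) (h g : Fin (m+3) → Matrix (Fin 2) (Fin 2) ℂ)
    (hp : h p = c • g (p + 1)) (hi : ∀ i, i ≠ p → h i = g (i + 1)) : C h = c • C g := by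
  rw [← C_shift g 1]
  exact C_one_site p c h _ hp hi

lemma C_eq_shift' {m : ℕ} (p : Fin (m+3)) (c : ℂ) (h g : Fin (m+3) → Matrix (Fin 2) (Fin 2) ℂ)
    (hp : h (p + 1) = c • g p) (hi : ∀ i, i ≠ p → h (i + 1) = g i) : C h = c • C g := by
  rw [← C_shift h 1]
  exact C_one_site p c _ _ hp hi

/-- last site -/
def lst (m : ℕ) : Fin (m+3) := ⟨m+2, by omega⟩

/-- left end y grows -/
lemma left_y {m : ℕ} (b : Matrix (Fin 2) (Fin 2) ℂ) (k : ℕ) (hk : k ≤ m) :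
    C (fun i : Fin (m+3) => sf sy b k i * bf (lst m) i) = (-Complex.I) • C (sf (m := m) sz b (k+1)) := by
  apply C_eq_shift 0
  · simp [sf, bf, lst, yz, Fin.ext_iff, val_add_one]
  · intro i hi
    have h2 := i.2
    simp only [sf, bf, lst, Fin.ext_iff, val_add_one, ne_eq, Fin.val_zero] at hi ⊢
    split_ifs <;> first | contradiction | omega | simp

/-- right end y grows -/
lemma right_y {m : ℕ} (a : Matrix (Fin 2) (Fin 2) ℂ) (k : ℕ) (hk : k ≤ m) :
    C (fun i : Fin (m+3) => sf a sy k i * bf ⟨k+1, by omega⟩ i) =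
      (-Complex.I) • C (sf (m := m) a sz (k+1)) := by
  apply C_one_site ⟨k+1, by omega⟩
  · simp [sf, bf, yz]
  · intro i hi
    have h2 := i.2
    simp only [sf, bf, Fin.ext_iff, val_add_one, ne_eq] at hi ⊢
    split_ifs <;> first | contradiction | omega | simp

/-- left end z shrinks -/
lemma left_z {m : ℕ} (b : Matrix (Fin 2) (Fin 2) ℂ) (k : ℕ) (hk : k ≤ m) :
    C (fun i : Fin (m+3) => sf sz b (k+1) i * bf 0 i) = Complex.I • C (sf (m := m) sy b k) := by
  apply C_eq_shift' 0
  · simp [sf, bf, xz, Fin.ext_iff, val_add_one]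
  · intro i hi
    have h2 := i.2
    simp only [sf, bf, Fin.ext_iff, val_add_one, ne_eq, Fin.val_zero] at hi ⊢
    split_ifs <;> first | contradiction | omega | simp [zz]

/-- right end z shrinks -/
lemma right_z {m : ℕ} (a : Matrix (Fin 2) (Fin 2) ℂ) (k : ℕ) (hk : k ≤ m) :
    C (fun i : Fin (m+3) => sf a sz (k+1) i * bf ⟨k+1, by omega⟩ i) =
      Complex.I • C (sf (m := m) a sy k) := by
  apply C_one_site ⟨k+1, by omega⟩
  · simp [sf, bf, xz]
  · intro i hi
    have h2 := i.2
    simp only [sf, bf, Fin.ext_iff, val_add_one, ne_eq] at hi ⊢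
    split_ifs <;> first | contradiction | omega | simp [zz]

/-- z y on adjacent sites gives x -/
lemma zy_zero {m : ℕ} :
    C (fun i : Fin (m+3) => sf sz sy 0 i * bf 0 i) = (-Complex.I) • C (xf (m := m)) := by
  apply C_eq_shift' 0
  · simp [sf, bf, xf, yz, Fin.ext_iff, val_add_one]
  · intro i hi
    have h2 := i.2
    simp only [sf, bf, xf, Fin.ext_iff, val_add_one, ne_eq, Fin.val_zero] at hi ⊢
    split_ifs <;> first | contradiction | omega | simp [zz]

lemma yz_zero {m : ℕ} :
    C (fun i : Fin (m+3) => sf sy sz 0 i * bf 0 i) = (-Complex.I) • C (xf (m := m)) := by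
  apply C_one_site 0
  · simp [sf, bf, xf, yz]
  · intro i hi
    have h2 := i.2
    simp only [sf, bf, xf, Fin.ext_iff, val_add_one, ne_eq, Fin.val_zero] at hi ⊢
    split_ifs <;> first | contradiction | omega | simp [zz]

lemma zy_full {m : ℕ} :
    C (fun i : Fin (m+3) => sf sz sy (m+1) i * bf (lst m) i) = (-Complex.I) • C (xxf (m := m)) := by
  apply C_eq_shift' (⟨m+1, by omega⟩)
  · simp [sf, bf, xxf, lst, yz, Fin.ext_iff, val_add_one]
  · intro i hi
    have h2 := i.2
    simp only [sf, bf, xxf, lst, Fin.ext_iff, val_add_one, ne_eq] at hi ⊢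
    split_ifs <;> first | contradiction | omega | simp [zz]

lemma yz_full {m : ℕ} :
    C (fun i : Fin (m+3) => sf sy sz (m+1) i * bf (lst m) i) = (-Complex.I) • C (xxf (m := m)) := by
  apply C_one_site 0
  · simp [sf, bf, xxf, lst, yz, Fin.ext_iff, val_add_one]
  · intro i hi
    have h2 := i.2
    simp only [sf, bf, xxf, lst, Fin.ext_iff, val_add_one, ne_eq, Fin.val_zero] at hi ⊢
    split_ifs <;> first | contradiction | omega | simp [zz]

lemma x_left {m : ℕ} :
    C (fun i : Fin (m+3) => xf i * bf (lst m) i) = Complex.I • C (sf (m := m) sz sy 0) := by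
  apply C_eq_shift 0
  · simp [sf, bf, xf, lst, xz, Fin.ext_iff, val_add_one]
  · intro i hi
    have h2 := i.2
    simp only [sf, bf, xf, lst, Fin.ext_iff, val_add_one, ne_eq, Fin.val_zero] at hi ⊢
    split_ifs <;> first | contradiction | omega | simp [zz]

lemma x_right {m : ℕ} :
    C (fun i : Fin (m+3) => xf i * bf 0 i) = Complex.I • C (sf (m := m) sy sz 0) := by
  apply C_one_site 0
  · simp [sf, bf, xf, xz]
  · intro i hi
    have h2 := i.2
    simp only [sf, bf, xf, Fin.ext_iff, val_add_one, ne_eq, Fin.val_zero] at hi ⊢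
    split_ifs <;> first | contradiction | omega | simp [zz]

lemma xx_left {m : ℕ} :
    C (fun i : Fin (m+3) => xxf i * bf ⟨m+1, by omega⟩ i) =
      Complex.I • C (sf (m := m) sz sy (m+1)) := by
  apply C_eq_shift (⟨m+1, by omega⟩)
  · simp [sf, bf, xxf, xz, val_add_one]
  · intro i hi
    have h2 := i.2
    simp only [sf, bf, xxf, Fin.ext_iff, val_add_one, ne_eq] at hi ⊢
    split_ifs <;> first | contradiction | omega | simp [zz]

lemma xx_right {m : ℕ} :
    C (fun i : Fin (m+3) => xxf i * bf (lst m) i) = Complex.I • C (sf (m := m) sy sz (m+1)) := by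
  apply C_one_site 0
  · simp [sf, bf, xxf, lst, xz, Fin.ext_iff, val_add_one]
  · intro i hi
    have h2 := i.2
    simp only [sf, bf, xxf, lst, Fin.ext_iff, val_add_one, ne_eq, Fin.val_zero] at hi ⊢
    split_ifs <;> first | contradiction | omega | simp [zz]

/-- Single site function for σx at `p`. -/
def xat {m : ℕ} (p i : Fin (m+3)) : Matrix (Fin 2) (Fin 2) ℂ := if i = p then sx else 1

lemma xf_eq {m : ℕ} (p i : Fin (m+3)) : xf (i - p) = xat p i := by
  unfold xf xat
  have h0 : ((i - p : Fin (m+3)) : ℕ) = 0 ↔ i = p := by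
    rw [← sub_eq_zero (a := i), Fin.ext_iff]; simp
  simp only [h0]

lemma x_comm {m : ℕ} (f : Fin (m+3) → Matrix (Fin 2) (Fin 2) ℂ) (e : Fin (m+3) → ℂ)
    (he : ∀ i, sx * f i = e i • (f i * sx)) :
    C f * C xf - C xf * C f = ∑ p, (1 - e p) • C (fun i => f i * xat p i) := by
  rw [C_comm' f xf (fun p i => if i = p then e i else 1)]
  · refine Finset.sum_congr rfl fun p _ => ?_
    simp only [xf_eq]
    congr 2
    simp
  · intro p i
    rw [xf_eq, xat]
    split_ifs <;> simp [he]

lemma xx_x_comm {m : ℕ} : C (xxf (m := m)) * C xf - C xf * C xxf = 0 := by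
  rw [x_comm xxf (fun _ => 1)]
  · simp
  · intro i
    unfold xxf
    split_ifs <;> simp

lemma x_x_comm {m : ℕ} : C (xf (m := m)) * C xf - C xf * C xf = 0 := sub_self _

lemma sf_x_comm {m : ℕ} (a b a' b' : Matrix (Fin 2) (Fin 2) ℂ) (c d : ℂ) (k : ℕ) (hk : k ≤ m + 1)
    (ha : a * sx = c • a') (ha' : sx * a = -(c • a'))
    (hb : b * sx = d • b') (hb' : sx * b = -(d • b')) :
    C (sf (m := m) a b k) * C xf - C xf * C (sf a b k) =
      (2 * c) • C (sf (m := m) a' b k) + (2 * d) • C (sf (m := m) a b' k) := by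
  have hk' : k + 1 < m + 3 := by omega
  have hne : (0 : Fin (m+3)) ≠ ⟨k+1, hk'⟩ := by
    simp [Fin.ext_iff]
  rw [x_comm (sf a b k) (fun i => if (i : ℕ) = 0 then -1 else if (i : ℕ) = k + 1 then -1 else 1),
    Finset.sum_eq_add 0 ⟨k+1, hk'⟩ hne]
  · have h1 : C (fun i : Fin (m+3) => sf a b k i * xat 0 i) = c • C (sf a' b k) := by
      apply C_one_site 0
      · simp [sf, xat, ha]
      · intro i hi
        simp only [sf, xat, Fin.ext_iff, ne_eq, Fin.val_zero] at hi ⊢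
        split_ifs <;> first | contradiction | omega | simp
    have h2 : C (fun i : Fin (m+3) => sf a b k i * xat ⟨k+1, hk'⟩ i) = d • C (sf a b' k) := by
      apply C_one_site ⟨k+1, hk'⟩
      · simp [sf, xat, hb]
      · intro i hi
        simp only [sf, xat, Fin.ext_iff, ne_eq] at hi ⊢
        split_ifs <;> first | contradiction | omega | simp
    rw [h1, h2, smul_smul, smul_smul]
    norm_num
  · rintro r - ⟨h1, h2⟩
    simp only [Fin.ext_iff, ne_eq, Fin.val_zero] at h1 h2
    simp [h1, h2]
  · simp
  · simp
  · intro i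
    simp only [sf]
    split_ifs <;> simp [ha, ha', hb, hb']

/-- The commutator with `B` as a linear map. -/
def D {n : ℕ} (B : M n) : M n →ₗ[ℂ] M n := LinearMap.mulRight ℂ B - LinearMap.mulLeft ℂ B

lemma D_apply {n : ℕ} (A B : M n) : D B A = A * B - B * A := by simp [D]

lemma Y_eq (m k : ℕ) : Y (m+3) k = Complex.I • C (sf (m := m) sy sy k) := by
  rw [Y, str, symmC_kron]; rfl
lemma Z_eq (m k : ℕ) : Z (m+3) k = Complex.I • C (sf (m := m) sz sz k) := by
  rw [Z, str, symmC_kron]; rfl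
lemma YZ_eq (m k : ℕ) : YZ (m+3) k =
    Complex.I • C (sf (m := m) sz sy k) + Complex.I • C (sf (m := m) sy sz k) := by
  rw [YZ, str, str, symmC_kron, symmC_kron]; rfl
lemma X_eq (m : ℕ) : X (m+3) = Complex.I • C (xf (m := m)) := by
  rw [X, symmC_kron]; rfl
lemma XX_eq (m : ℕ) : XX (m+3) = Complex.I • C (xxf (m := m)) := by
  rw [XX, symmC_kron]; rfl

lemma D_smul_smul {n : ℕ} (A B : M n) :
    D (Complex.I • B) (Complex.I • A) = -(A * B - B * A) := by
  rw [D_apply]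
  simp only [smul_mul_assoc, mul_smul_comm, smul_smul, Complex.I_mul_I]
  rw [← smul_sub]; simp

lemma hyx' : sx * sy = -(Complex.I • sz) := by rw [xy, neg_smul]
lemma hzx' : sx * sz = -((-Complex.I) • sy) := by rw [xz, neg_smul, neg_neg]

lemma Y_X (m k : ℕ) (hk : k ≤ m + 1) : D (X (m+3)) (Y (m+3) k) = (-2 : ℂ) • YZ (m+3) k := by
  rw [X_eq, Y_eq, YZ_eq, D_smul_smul,
    sf_x_comm sy sy sz sz Complex.I Complex.I k hk yx hyx' yx hyx']
  module

lemma Z_X (m k : ℕ) (hk : k ≤ m + 1) : D (X (m+3)) (Z (m+3) k) = (2 : ℂ) • YZ (m+3) k := by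
  rw [X_eq, Z_eq, YZ_eq, D_smul_smul,
    sf_x_comm sz sz sy sy (-Complex.I) (-Complex.I) k hk zx hzx' zx hzx']
  module

lemma YZ_X (m k : ℕ) (hk : k ≤ m + 1) :
    D (X (m+3)) (YZ (m+3) k) = (4 : ℂ) • (Y (m+3) k - Z (m+3) k) := by
  rw [X_eq, Z_eq, Y_eq, YZ_eq, map_add, D_smul_smul, D_smul_smul,
    sf_x_comm sz sy sy sz (-Complex.I) (Complex.I) k hk zx hzx' yx hyx',
    sf_x_comm sy sz sz sy (Complex.I) (-Complex.I) k hk yx hyx' zx hzx']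
  module

lemma X_X (m : ℕ) : D (X (m+3)) (X (m+3)) = 0 := by rw [D_apply, sub_self]

lemma XX_X (m : ℕ) : D (X (m+3)) (XX (m+3)) = 0 := by
  rw [X_eq, XX_eq, D_smul_smul, xx_x_comm, neg_zero]

lemma Y_Z (m k : ℕ) (hk : k ≤ m) : D (Z (m+3) 0) (Y (m+3) k) = (2 : ℂ) • YZ (m+3) (k+1) := by
  rw [Z_eq, Y_eq, YZ_eq, D_smul_smul,
    bond_comm_two (sf sy sy k) (ef (-1) (-1) k) (sf_ef _ _ _ _ k hy hy) (lst m) ⟨k+1, by omega⟩,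
    left_y _ k hk, right_y _ k hk]
  · module
  · simp [lst, Fin.ext_iff]; omega
  · simp only [ef, lst, val_add_one]
    split_ifs <;> first | contradiction | omega | (norm_num; done) |
      (have q : ¬ (m + 2 ≤ k) := by omega
       by_cases q2 : m + 2 = k + 1 <;> first | omega | simp [q, q2])
  · simp only [ef, lst, val_add_one]
    split_ifs <;> first | contradiction | omega | (norm_num; done) |
      (have q : ¬ (m + 2 ≤ k) := by omega
       by_cases q2 : m + 2 = k + 1 <;> first | omega | simp [q, q2])
  · intro r h1 h2
    have h3 := r.2
    simp only [ef, lst, Fin.ext_iff, val_add_one, ne_eq] at h1 h2 ⊢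
    split_ifs <;> first | contradiction | omega | norm_num

lemma Y_Z_last (m : ℕ) : D (Z (m+3) 0) (Y (m+3) (m+1)) = 0 := by
  rw [Z_eq, Y_eq, D_smul_smul,
    bond_comm_none (sf sy sy (m+1)) (ef (-1) (-1) (m+1)) (sf_ef _ _ _ _ _ hy hy), neg_zero]
  intro r
  have h3 := r.2
  simp only [ef, val_add_one]
  split_ifs <;> first | contradiction | omega | norm_num

lemma Z_Z (m k : ℕ) (hk : k ≤ m) : D (Z (m+3) 0) (Z (m+3) (k+1)) = (-2 : ℂ) • YZ (m+3) k := by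
  rw [Z_eq, Z_eq, YZ_eq, D_smul_smul,
    bond_comm_two (sf sz sz (k+1)) (ef 1 1 (k+1)) (sf_ef _ _ _ _ _ hz hz) 0 ⟨k+1, by omega⟩,
    left_z _ k hk, right_z _ k hk]
  · module
  · simp [Fin.ext_iff]
  · simp only [ef, val_add_one, Fin.val_zero]
    split_ifs <;> first | contradiction | omega | norm_num
  · simp only [ef, val_add_one]
    split_ifs <;> first | contradiction | omega | norm_num
  · intro r h1 h2
    have h3 := r.2
    simp only [ef, Fin.ext_iff, val_add_one, ne_eq, Fin.val_zero] at h1 h2 ⊢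
    split_ifs <;> first | contradiction | omega | norm_num

lemma Z_Z_zero (m : ℕ) : D (Z (m+3) 0) (Z (m+3) 0) = 0 := by rw [D_apply, sub_self]

lemma zy_bond (m k : ℕ) (hk : k ≤ m + 1) :
    C (sf (m := m) sz sy k) * C (sf sz sz 0) - C (sf sz sz 0) * C (sf sz sy k) =
      (2 : ℂ) • C (fun i : Fin (m+3) => sf sz sy k i * bf 0 i) +
      (2 : ℂ) • C (fun i : Fin (m+3) => sf sz sy k i * bf ⟨k+1, by omega⟩ i) := by
  apply bond_comm_two (sf sz sy k) (ef 1 (-1) k) (sf_ef _ _ _ _ _ hz hy)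
  · simp [Fin.ext_iff]
  · simp only [ef, val_add_one, Fin.val_zero]
    split_ifs <;> first | contradiction | omega | norm_num
  · simp only [ef, val_add_one]
    split_ifs <;> first | contradiction | omega | norm_num
  · intro r h1 h2
    have h3 := r.2
    simp only [ef, Fin.ext_iff, val_add_one, ne_eq, Fin.val_zero] at h1 h2 ⊢
    split_ifs <;> first | contradiction | omega | norm_num

lemma yz_bond (m k : ℕ) (hk : k ≤ m + 1) :
    C (sf (m := m) sy sz k) * C (sf sz sz 0) - C (sf sz sz 0) * C (sf sy sz k) =
      (2 : ℂ) • C (fun i : Fin (m+3) => sf sy sz k i * bf (lst m) i) +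
      (2 : ℂ) • C (fun i : Fin (m+3) => sf sy sz k i * bf ⟨k, by omega⟩ i) := by
  apply bond_comm_two (sf sy sz k) (ef (-1) 1 k) (sf_ef _ _ _ _ _ hy hz)
  · simp [lst, Fin.ext_iff]; omega
  · simp only [ef, lst, val_add_one]
    split_ifs <;> first | contradiction | omega | (norm_num; done) |
      (have q : ¬ (m + 2 ≤ k) := by omega
       by_cases q2 : m + 2 = k + 1 <;> first | omega | simp [q, q2])
  · simp only [ef, val_add_one]
    split_ifs <;> first | contradiction | omega | norm_num
  · intro r h1 h2
    have h3 := r.2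
    simp only [ef, lst, Fin.ext_iff, val_add_one, ne_eq] at h1 h2 ⊢
    split_ifs <;> first | contradiction | omega | norm_num

lemma YZ_Z (m k : ℕ) (hk : k + 1 ≤ m) :
    D (Z (m+3) 0) (YZ (m+3) (k+1)) = (4 : ℂ) • (Z (m+3) (k+2) - Y (m+3) k) := by
  rw [Z_eq, Z_eq, Y_eq, YZ_eq, map_add, D_smul_smul, D_smul_smul, zy_bond m (k+1) (by omega),
    yz_bond m (k+1) (by omega), left_z _ k (by omega), right_z _ k (by omega), left_y _ _ hk,
    right_y _ _ hk]
  module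

lemma YZ_Z_zero (m : ℕ) :
    D (Z (m+3) 0) (YZ (m+3) 0) = (4 : ℂ) • (X (m+3) + Z (m+3) 1) := by
  have e : (⟨0, by omega⟩ : Fin (m+3)) = 0 := rfl
  rw [Z_eq, Z_eq, X_eq, YZ_eq, map_add, D_smul_smul, D_smul_smul, zy_bond m 0 (by omega),
    yz_bond m 0 (by omega), e, zy_zero, yz_zero, left_y _ _ (by omega),
    right_y _ _ (by omega)]
  module

lemma YZ_Z_last (m : ℕ) :
    D (Z (m+3) 0) (YZ (m+3) (m+1)) = (4 : ℂ) • (XX (m+3) - Y (m+3) m) := by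
  have e : (⟨m + 1 + 1, by omega⟩ : Fin (m+3)) = lst m := rfl
  rw [Z_eq, XX_eq, Y_eq, YZ_eq, map_add, D_smul_smul, D_smul_smul, zy_bond m (m+1) (by omega),
    yz_bond m (m+1) (by omega), e, zy_full, yz_full, left_z _ _ (by omega),
    right_z _ _ (by omega)]
  module

lemma X_Z (m : ℕ) : D (Z (m+3) 0) (X (m+3)) = (-2 : ℂ) • YZ (m+3) 0 := by
  rw [Z_eq, X_eq, YZ_eq, D_smul_smul,
    bond_comm_two xf (fun i => if (i : ℕ) = 0 then -1 else 1) _ (lst m) 0, x_left, x_right]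
  · module
  · simp [lst, Fin.ext_iff]
  · simp [lst, val_add_one]
  · simp [val_add_one]
  · intro r h1 h2
    have h3 := r.2
    simp only [lst, Fin.ext_iff, val_add_one, ne_eq, Fin.val_zero] at h1 h2 ⊢
    split_ifs <;> first | contradiction | omega | norm_num
  · intro i
    simp only [xf]
    split_ifs <;> simp [xz, zx]

lemma XX_Z (m : ℕ) : D (Z (m+3) 0) (XX (m+3)) = (-2 : ℂ) • YZ (m+3) (m+1) := by
  rw [Z_eq, XX_eq, YZ_eq, D_smul_smul,
    bond_comm_two xxf (fun i => if (i : ℕ) = m + 2 then 1 else -1) _ ⟨m+1, by omega⟩ (lst m),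
    xx_left, xx_right]
  · module
  · simp [lst, Fin.ext_iff]
  · simp [val_add_one]
  · simp [lst, val_add_one]
  · intro r h1 h2
    have h3 := r.2
    simp only [lst, Fin.ext_iff, val_add_one, ne_eq] at h1 h2 ⊢
    split_ifs <;> first | contradiction | omega | norm_num
  · intro i
    simp only [xxf]
    split_ifs <;> simp [xz, zx]

lemma D_smul_real {n : ℕ} (A B : M n) (r : ℝ) : D B (r • A) = r • D B A := by
  rw [D_apply, D_apply, smul_mul_assoc, mul_smul_comm, smul_sub]

lemma key_sum {V : Type*} [AddCommGroup V] [Module ℝ V] (lam : ℝ) (m : ℕ)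
    (h : aSeq lam (m + 2) = 0) (v : ℕ → V) :
    ∑ k ∈ Finset.range (m+1), aSeq lam k • v (k+1) + ∑ k ∈ Finset.range (m+1), aSeq lam (k+1) • v k
      = lam • ∑ k ∈ Finset.range (m+2), aSeq lam k • v k := by
  have h1 : ∑ k ∈ Finset.range (m+2), aSeq lam (k+1) • v k =
      ∑ k ∈ Finset.range (m+1), aSeq lam (k+1) • v k := by
    rw [Finset.sum_range_succ, h, zero_smul, add_zero]
  rw [← h1, Finset.sum_range_succ' _ (m+1), Finset.sum_range_succ' _ (m+1), smul_add,
    Finset.smul_sum, ← add_assoc, ← Finset.sum_add_distrib]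
  congr 1
  · refine Finset.sum_congr rfl fun k _ => ?_
    rw [← add_smul, smul_smul]
    congr 1
    simp only [aSeq]
    ring
  · simp [aSeq]

lemma Xhat_eq (m : ℕ) (lam : ℝ) : Xhat (m+3) lam =
    (X (m+3) + Z (m+3) 1) + aSeq lam (m+1) • (XX (m+3) - Y (m+3) m) +
      ∑ k ∈ Finset.range m, aSeq lam (k+1) • (Z (m+3) (k+2) - Y (m+3) k) := by
  unfold Xhat
  congr 1
  exact (Finset.sum_Ico_add' (fun k => aSeq lam k • (Z (m+3) (k + 1) - Y (m+3) (k - 1)))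
    0 m 1).symm.trans (by rw [Finset.range_eq_Ico]; rfl)

lemma cs {n : ℕ} (r : ℝ) (A : M n) : (r : ℂ) • A = r • A := by
  ext i j; simp

lemma main_aux (m : ℕ) (lam : ℝ) (hroot : aSeq lam (m + 2) = 0) :
    D (X (m+3)) (Xhat (m+3) lam) = (2 * lam) • Zhat (m+3) lam ∧
    D (X (m+3)) (Yhat (m+3) lam) = (-4 : ℝ) • Zhat (m+3) lam ∧
    D (X (m+3)) (Zhat (m+3) lam) = (4 : ℝ) • Yhat (m+3) lam ∧
    D (Z (m+3) 0) (Xhat (m+3) lam) = (-4 : ℝ) • Zhat (m+3) lam ∧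
    D (Z (m+3) 0) (Yhat (m+3) lam) = (2 * lam) • Zhat (m+3) lam ∧
    D (Z (m+3) 0) (Zhat (m+3) lam) = (4 : ℝ) • Xhat (m+3) lam := by
  have c2 : ∀ A : M (m+3), (2 : ℂ) • A = (2 : ℝ) • A := fun A => by rw [← cs]; simp
  have c2' : ∀ A : M (m+3), (-2 : ℂ) • A = (-2 : ℝ) • A := fun A => by rw [← cs]; simp
  have c4 : ∀ A : M (m+3), (4 : ℂ) • A = (4 : ℝ) • A := fun A => by rw [← cs]; simp
  have hYhat : Yhat (m+3) lam =
    ∑ k ∈ Finset.range (m+2), aSeq lam k • (Y (m+3) k - Z (m+3) k) := rfl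
  have hZhat : Zhat (m+3) lam = ∑ k ∈ Finset.range (m+2), aSeq lam k • YZ (m+3) k := rfl
  have ks := key_sum lam m hroot (YZ (m+3))
  have a0 : aSeq lam 0 = 1 := rfl
  refine ⟨?_, ?_, ?_, ?_, ?_, ?_⟩
  · rw [mul_smul, hZhat, ← ks, Xhat_eq]
    simp only [map_add, D_smul_real, map_sum, map_sub]
    rw [X_X, XX_X, Z_X m 1 (by omega), Y_X m m (by omega)]
    have : ∀ k ∈ Finset.range m, aSeq lam (k+1) • (D (X (m+3)) (Z (m+3) (k+2)) -
        D (X (m+3)) (Y (m+3) k)) = (2 : ℝ) • (aSeq lam (k+1) • YZ (m+3) (k+1+1)) +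
          (2 : ℝ) • (aSeq lam (k+1) • YZ (m+3) k) := by
      intro k hk
      rw [Finset.mem_range] at hk
      rw [Z_X m _ (by omega), Y_X m k (by omega), c2, c2']
      module
    rw [Finset.sum_congr rfl this, Finset.sum_add_distrib, ← Finset.smul_sum, ← Finset.smul_sum,
      Finset.sum_range_succ' _ m, Finset.sum_range_succ _ m, a0, c2, c2', zero_add 1]
    module
  · rw [hYhat, hZhat, map_sum, Finset.smul_sum]
    refine Finset.sum_congr rfl fun k hk => ?_
    rw [Finset.mem_range] at hk
    rw [D_smul_real, map_sub, Y_X m k (by omega), Z_X m k (by omega), c2, c2']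
    module
  · rw [hYhat, hZhat, map_sum, Finset.smul_sum]
    refine Finset.sum_congr rfl fun k hk => ?_
    rw [Finset.mem_range] at hk
    rw [D_smul_real, YZ_X m k (by omega), c4]
    module
  · rw [hZhat, Xhat_eq]
    simp only [map_add, D_smul_real, map_sum, map_sub]
    rw [X_Z, XX_Z, Z_Z m 0 (by omega), Y_Z m m le_rfl]
    have : ∀ k ∈ Finset.range m, aSeq lam (k+1) • (D (Z (m+3) 0) (Z (m+3) (k+2)) -
        D (Z (m+3) 0) (Y (m+3) k)) = (-4 : ℝ) • (aSeq lam (k+1) • YZ (m+3) (k+1)) := by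
      intro k hk
      rw [Finset.mem_range] at hk
      rw [Z_Z m (k+1) (by omega), Y_Z m k (by omega), c2, c2']
      module
    rw [Finset.sum_congr rfl this, ← Finset.smul_sum, Finset.sum_range_succ,
      Finset.sum_range_succ' _ m, a0, c2, c2', c2']
    module
  · rw [mul_smul, hYhat, hZhat, ← ks, map_sum]
    simp only [D_smul_real, map_sub, smul_sub, Finset.sum_sub_distrib]
    rw [Finset.sum_range_succ, Finset.sum_range_succ' _ (m+1), Y_Z_last, Z_Z_zero]
    have h1 : ∀ k ∈ Finset.range (m+1), aSeq lam k • D (Z (m+3) 0) (Y (m+3) k) =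
        (2 : ℝ) • (aSeq lam k • YZ (m+3) (k+1)) := by
      intro k hk
      rw [Finset.mem_range] at hk
      rw [Y_Z m k (by omega), c2]
      module
    have h2 : ∀ k ∈ Finset.range (m+1), aSeq lam (k+1) • D (Z (m+3) 0) (Z (m+3) (k+1)) =
        (-2 : ℝ) • (aSeq lam (k+1) • YZ (m+3) k) := by
      intro k hk
      rw [Finset.mem_range] at hk
      rw [Z_Z m k (by omega), c2']
      module
    rw [Finset.sum_congr rfl h1, Finset.sum_congr rfl h2, ← Finset.smul_sum, ← Finset.smul_sum]
    module
  · rw [hZhat, Xhat_eq, map_sum]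
    simp only [D_smul_real]
    rw [Finset.sum_range_succ, Finset.sum_range_succ', YZ_Z_zero, YZ_Z_last]
    have h1 : ∀ k ∈ Finset.range m, aSeq lam (k+1) • D (Z (m+3) 0) (YZ (m+3) (k+1)) =
        (4 : ℝ) • (aSeq lam (k+1) • (Z (m+3) (k+2) - Y (m+3) k)) := by
      intro k hk
      rw [Finset.mem_range] at hk
      rw [YZ_Z m k (by omega), c4]
      module
    rw [Finset.sum_congr rfl h1, ← Finset.smul_sum, a0, c4, c4]
    module

/-- For every `n ≥ 3` and every real root `λ̄` of `a_{n-1}`: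
`[X̂, X] = 2λ̄ Ẑ`, `[Ŷ, X] = -4 Ẑ`, `[Ẑ, X] = 4 Ŷ`, `[X̂, Z⁰] = -4 Ẑ`,
`[Ŷ, Z⁰] = 2λ̄ Ẑ`, `[Ẑ, Z⁰] = 4 X̂`. -/
theorem stmt11 (n : ℕ) (hn : 3 ≤ n) (lam : ℝ) (hroot : aSeq lam (n - 1) = 0) :
    ⁅Xhat n lam, X n⁆ = (2 * lam) • Zhat n lam ∧
    ⁅Yhat n lam, X n⁆ = (-4 : ℝ) • Zhat n lam ∧
    ⁅Zhat n lam, X n⁆ = (4 : ℝ) • Yhat n lam ∧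
    ⁅Xhat n lam, Z n 0⁆ = (-4 : ℝ) • Zhat n lam ∧
    ⁅Yhat n lam, Z n 0⁆ = (2 * lam) • Zhat n lam ∧
    ⁅Zhat n lam, Z n 0⁆ = (4 : ℝ) • Xhat n lam := by
  obtain ⟨m, rfl⟩ : ∃ m, n = m + 3 := ⟨n - 3, by omega⟩
  have h := main_aux m lam hroot
  simp only [D_apply] at h
  exact h

end
end Ising
end

section
/- For every n ≥ 3 and any two distinct real roots λ̄1 ≠ λ̄2 of the polynomial a_{n−1}, the corresponding subspaces satisfy I_{λ̄1} ∩ I_{λ̄2} = {0}. -/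
namespace Ising

noncomputable section

open Matrix

attribute [local instance 100] LieRing.ofAssociativeRing

/-- The generating matrix `1 + u σx + v σy + w σz` over `ℂ[u]`. -/
def gMat (v w : ℂ) : Fin 2 → Fin 2 → Polynomial ℂ := fun a b =>
  Polynomial.C ((1 : Matrix (Fin 2) (Fin 2) ℂ) a b) + Polynomial.X * Polynomial.C (sx a b)
    + Polynomial.C (v * sy a b) + Polynomial.C (w * sz a b)

/-- The generating functional `A ↦ tr (G^{⊗ n} A)`. -/
def phi (n : ℕ) (v w : ℂ) : M n →ₗ[ℂ] Polynomial ℂ where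
  toFun A := ∑ x, ∑ y, A x y • ∏ j, gMat v w (y j) (x j)
  map_add' A B := by simp [add_smul, Finset.sum_add_distrib]
  map_smul' c A := by simp [Finset.smul_sum, smul_smul]

/-- The single-factor trace. -/
def tr1 (v w : ℂ) (f : Matrix (Fin 2) (Fin 2) ℂ) : Polynomial ℂ :=
  ∑ a, ∑ b, f a b • gMat v w b a

lemma phi_kron (n : ℕ) (v w : ℂ) (f : Fin n → Matrix (Fin 2) (Fin 2) ℂ) :
    phi n v w (kron f) = ∏ j, tr1 v w (f j) := by
  have h : ∀ j, tr1 v w (f j) = ∑ a, ∑ b, f j a b • gMat v w b a := fun _ => rfl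
  simp only [h]
  rw [Finset.prod_univ_sum]
  simp only [Fintype.piFinset_univ]
  change (∑ x, ∑ y, kron f x y • ∏ j, gMat v w (y j) (x j)) = _
  refine Finset.sum_congr rfl fun x _ => ?_
  rw [Finset.prod_univ_sum]
  simp only [Fintype.piFinset_univ]
  refine Finset.sum_congr rfl fun y _ => ?_
  rw [kron, Finset.prod_smul]

lemma tr1_one (v w : ℂ) : tr1 v w 1 = Polynomial.C 2 := by
  simp [tr1, gMat, sx, sy, sz, Fin.sum_univ_two]
  rw [← Polynomial.C_neg, ← Polynomial.C_1]
  simp only [← Polynomial.C_add, ← Polynomial.C_neg]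
  congr 1; ring

lemma C_two : (Polynomial.C (2 : ℂ)) = 2 := rfl

lemma tr1_sx (v w : ℂ) : tr1 v w sx = Polynomial.C 2 * Polynomial.X := by
  simp [tr1, gMat, sx, sy, sz, Fin.sum_univ_two]
  rw [C_two]; ring

lemma C_I_sq : (Polynomial.C Complex.I) ^ 2 = -1 := by
  rw [← Polynomial.C_pow, Complex.I_sq]; simp

lemma tr1_sy (v w : ℂ) : tr1 v w sy = Polynomial.C 2 * Polynomial.C v := by
  simp [tr1, gMat, sx, sy, sz, Fin.sum_univ_two, Polynomial.smul_eq_C_mul]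
  rw [C_two]
  linear_combination (-2 * Polynomial.C v) * C_I_sq

lemma tr1_sz (v w : ℂ) : tr1 v w sz = Polynomial.C 2 * Polynomial.C w := by
  simp [tr1, gMat, sx, sy, sz, Fin.sum_univ_two]
  rw [C_two]; ring

/-- The rotation of configurations. -/
def rotE (n : ℕ) : (Fin n → Fin 2) ≃ (Fin n → Fin 2) :=
  Equiv.arrowCongr (finRotate n) (Equiv.refl _)

lemma rotE_iff (n : ℕ) (x z : Fin n → Fin 2) :
    (x = fun i => z (finRotate n i)) ↔ z = rotE n x := by
  constructor
  · rintro rfl; funext i; simp [rotE, Equiv.arrowCongr, -finRotate_apply, -finRotate_symm_apply]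
  · rintro rfl; funext i; simp [rotE, Equiv.arrowCongr, -finRotate_apply, -finRotate_symm_apply]

lemma P_conj (n : ℕ) (A : M n) :
    P n * A * (P n)ᵀ = A.submatrix (rotE n) (rotE n) := by
  ext x y
  simp only [Matrix.mul_apply, Matrix.transpose_apply, P, rotE_iff]
  simp

lemma P_inv (n : ℕ) : (P n)⁻¹ = (P n)ᵀ := by
  apply Matrix.inv_eq_right_inv
  have := P_conj n 1
  simpa using this

lemma phi_conj (n : ℕ) (v w : ℂ) (A : M n) :
    phi n v w (P n * A * (P n)⁻¹) = phi n v w A := by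
  rw [P_inv, P_conj]
  change (∑ x, ∑ y, A (rotE n x) (rotE n y) • ∏ j, gMat v w (y j) (x j))
    = ∑ x, ∑ y, A x y • ∏ j, gMat v w (y j) (x j)
  refine Fintype.sum_equiv (rotE n) _ _ fun x => ?_
  refine Fintype.sum_equiv (rotE n) _ _ fun y => ?_
  congr 1
  refine Fintype.prod_equiv (finRotate n) _ _ fun j => ?_
  simp [rotE, Equiv.arrowCongr, -finRotate_apply, -finRotate_symm_apply]

lemma phi_conj_pow (n : ℕ) (v w : ℂ) (A : M n) (k : ℕ) :
    phi n v w (P n ^ k * A * (P n ^ k)⁻¹) = phi n v w A := by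
  induction k with
  | zero => simp
  | succ k ih =>
    rw [pow_succ', Matrix.mul_inv_rev, ← ih]
    rw [← phi_conj n v w (P n ^ k * A * (P n ^ k)⁻¹)]
    simp only [Matrix.mul_assoc]

lemma phi_symmC (n : ℕ) (v w : ℂ) (A : M n) :
    phi n v w (symmC A) = (n : ℂ) • phi n v w A := by
  simp [symmC, phi_conj_pow, Polynomial.smul_eq_C_mul]

lemma phi_str (n : ℕ) (v w : ℂ) (a b : Matrix (Fin 2) (Fin 2) ℂ) (p q : ℂ)
    (ha : tr1 v w a = Polynomial.C 2 * Polynomial.C p)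
    (hb : tr1 v w b = Polynomial.C 2 * Polynomial.C q) (j : ℕ) (hj : j + 2 ≤ n) :
    phi n v w (str n a b j) = ((2 : ℂ) ^ n * (p * q)) • (Polynomial.X : Polynomial ℂ) ^ j := by
  rw [str, phi_kron]
  have h : ∀ i : Fin n, tr1 v w (if (i : ℕ) = 0 then a else if (i : ℕ) = j + 1 then b
      else if (i : ℕ) ≤ j then sx else 1) = (fun i : ℕ => Polynomial.C 2 * 
        (if i = 0 then Polynomial.C p else if i = j + 1 then Polynomial.C q
          else if i ≤ j then Polynomial.X else 1)) (i : ℕ) := by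
    intro i
    dsimp only
    split_ifs <;> simp only [ha, hb, tr1_sx, tr1_one, mul_one]
  rw [Finset.prod_congr rfl fun i _ => h i, Fin.prod_univ_eq_prod_range
    (fun i : ℕ => Polynomial.C 2 * 
        (if i = 0 then Polynomial.C p else if i = j + 1 then Polynomial.C q
          else if i ≤ j then Polynomial.X else 1)) n, Finset.prod_mul_distrib]
  obtain ⟨m, rfl⟩ := Nat.exists_eq_add_of_le hj
  rw [Finset.prod_const, Finset.card_range, Finset.prod_range_add _ (j + 2) m, Finset.prod_range_succ, Finset.prod_range_succ']
  have e1 : ∏ k ∈ Finset.range j, (if k + 1 = 0 then Polynomial.C p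
      else if k + 1 = j + 1 then Polynomial.C q
          else if k + 1 ≤ j then Polynomial.X else 1) = (Polynomial.X : Polynomial ℂ) ^ j := by
    rw [Finset.prod_congr rfl (g := fun _ => (Polynomial.X : Polynomial ℂ))]
    · simp
    · intro k hk
      have := Finset.mem_range.1 hk
      rw [if_neg (by omega), if_neg (by omega), if_pos (by omega)]
  have e2 : ∏ k ∈ Finset.range m, (if j + 2 + k = 0 then Polynomial.C p
      else if j + 2 + k = j + 1 then Polynomial.C q
          else if j + 2 + k ≤ j then Polynomial.X else 1) = (1 : Polynomial ℂ) := by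
    apply Finset.prod_eq_one
    intro k hk
    rw [if_neg (by omega), if_neg (by omega), if_neg (by omega)]
  rw [e1, e2]
  simp [Polynomial.smul_eq_C_mul]
  ring

lemma phi_X0 (n : ℕ) (hn : 3 ≤ n) (v w : ℂ) :
    phi n v w (kron fun i : Fin n => if (i : ℕ) = 0 then sx else 1)
      = ((2 : ℂ) ^ n) • (Polynomial.X : Polynomial ℂ) := by
  rw [phi_kron]
  obtain ⟨m, rfl⟩ : ∃ m, n = m + 1 := ⟨n - 1, by omega⟩
  rw [Fin.prod_univ_succ]
  simp [tr1_sx, tr1_one, Polynomial.smul_eq_C_mul]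
  ring

lemma phi_XX0 (n : ℕ) (hn : 3 ≤ n) (v w : ℂ) :
    phi n v w (kron fun i : Fin n => if (i : ℕ) = n - 1 then 1 else sx)
      = ((2 : ℂ) ^ n) • (Polynomial.X : Polynomial ℂ) ^ (n - 1) := by
  rw [phi_kron]
  obtain ⟨m, rfl⟩ : ∃ m, n = m + 1 := ⟨n - 1, by omega⟩
  rw [Fin.prod_univ_castSucc]
  have : ∀ i : Fin m, (i : ℕ) ≠ m := fun i => i.2.ne
  simp [tr1_sx, tr1_one, Polynomial.smul_eq_C_mul, this]
  ring

/-- The common scalar. -/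
def cst (n : ℕ) : ℂ := Complex.I * (n * 2 ^ n)

lemma cst_ne (n : ℕ) (hn : 3 ≤ n) : cst n ≠ 0 := by
  have : (n : ℂ) ≠ 0 := by exact_mod_cast (by omega : n ≠ 0)
  simp [cst, this]

lemma phi_Y (n : ℕ) (v w : ℂ) (j : ℕ) (hj : j + 2 ≤ n) :
    phi n v w (Y n j) = (cst n * v ^ 2) • (Polynomial.X : Polynomial ℂ) ^ j := by
  rw [Y, map_smul, phi_symmC, phi_str n v w sy sy v v (tr1_sy v w) (tr1_sy v w) j hj,
    smul_smul, smul_smul, cst]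
  congr 1; ring

lemma phi_Z (n : ℕ) (v w : ℂ) (j : ℕ) (hj : j + 2 ≤ n) :
    phi n v w (Z n j) = (cst n * w ^ 2) • (Polynomial.X : Polynomial ℂ) ^ j := by
  rw [Z, map_smul, phi_symmC, phi_str n v w sz sz w w (tr1_sz v w) (tr1_sz v w) j hj,
    smul_smul, smul_smul, cst]
  congr 1; ring

lemma phi_YZ (n : ℕ) (v w : ℂ) (j : ℕ) (hj : j + 2 ≤ n) :
    phi n v w (YZ n j) = (cst n * (2 * v * w)) • (Polynomial.X : Polynomial ℂ) ^ j := by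
  rw [YZ, map_add, map_smul, map_smul, phi_symmC, phi_symmC,
    phi_str n v w sz sy w v (tr1_sz v w) (tr1_sy v w) j hj,
    phi_str n v w sy sz v w (tr1_sy v w) (tr1_sz v w) j hj,
    smul_smul, smul_smul, smul_smul, smul_smul, ← add_smul, cst]
  congr 1; ring

lemma phi_X (n : ℕ) (hn : 3 ≤ n) (v w : ℂ) :
    phi n v w (X n) = cst n • (Polynomial.X : Polynomial ℂ) := by
  rw [X, map_smul, phi_symmC, phi_X0 n hn, smul_smul, smul_smul, cst]
  congr 1; ring

lemma phi_XX (n : ℕ) (hn : 3 ≤ n) (v w : ℂ) :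
    phi n v w (XX n) = cst n • (Polynomial.X : Polynomial ℂ) ^ (n - 1) := by
  rw [XX, map_smul, phi_symmC, phi_XX0 n hn, smul_smul, smul_smul, cst]
  congr 1; ring

lemma phi_rsmul (n : ℕ) (v w : ℂ) (r : ℝ) (A : M n) :
    phi n v w (r • A) = (r : ℂ) • phi n v w A := by
  rw [← map_smul]
  congr 1

/-- Coefficients of `phi`. -/
def cf (n : ℕ) (v w : ℂ) (d : ℕ) : M n →ₗ[ℂ] ℂ := Polynomial.lcoeff ℂ d ∘ₗ phi n v w

lemma cf_apply (n : ℕ) (v w : ℂ) (d : ℕ) (A : M n) :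
    cf n v w d A = (phi n v w A).coeff d := rfl

lemma cf_rsmul (n : ℕ) (v w : ℂ) (d : ℕ) (r : ℝ) (A : M n) :
    cf n v w d (r • A) = (r : ℂ) * cf n v w d A := by
  rw [cf_apply, phi_rsmul, Polynomial.coeff_smul, smul_eq_mul, cf_apply]

lemma cf_Y (n : ℕ) (v w : ℂ) (d j : ℕ) (hj : j + 2 ≤ n) :
    cf n v w d (Y n j) = cst n * v ^ 2 * (if d = j then 1 else 0) := by
  rw [cf_apply, phi_Y n v w j hj, Polynomial.coeff_smul, smul_eq_mul, Polynomial.coeff_X_pow]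

lemma cf_Z (n : ℕ) (v w : ℂ) (d j : ℕ) (hj : j + 2 ≤ n) :
    cf n v w d (Z n j) = cst n * w ^ 2 * (if d = j then 1 else 0) := by
  rw [cf_apply, phi_Z n v w j hj, Polynomial.coeff_smul, smul_eq_mul, Polynomial.coeff_X_pow]

lemma cf_YZ (n : ℕ) (v w : ℂ) (d j : ℕ) (hj : j + 2 ≤ n) :
    cf n v w d (YZ n j) = cst n * (2 * v * w) * (if d = j then 1 else 0) := by
  rw [cf_apply, phi_YZ n v w j hj, Polynomial.coeff_smul, smul_eq_mul, Polynomial.coeff_X_pow]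

lemma cf_X (n : ℕ) (hn : 3 ≤ n) (v w : ℂ) (d : ℕ) :
    cf n v w d (X n) = cst n * (if 1 = d then 1 else 0) := by
  rw [cf_apply, phi_X n hn v w, Polynomial.coeff_smul, smul_eq_mul, Polynomial.coeff_X]

lemma cf_XX (n : ℕ) (hn : 3 ≤ n) (v w : ℂ) (d : ℕ) :
    cf n v w d (XX n) = cst n * (if d = n - 1 then 1 else 0) := by
  rw [cf_apply, phi_XX n hn v w, Polynomial.coeff_smul, smul_eq_mul, Polynomial.coeff_X_pow]

lemma cf_Yhat (n : ℕ) (v w : ℂ) (lam : ℝ) (d : ℕ) (hd : d + 2 ≤ n) :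
    cf n v w d (Yhat n lam) = cst n * (aSeq lam d * (v ^ 2 - w ^ 2)) := by
  rw [Yhat, map_sum, Finset.sum_eq_single d]
  · rw [cf_rsmul, map_sub, cf_Y _ _ _ _ _ hd, cf_Z _ _ _ _ _ hd, if_pos rfl]; ring
  · intro k hk hkd
    have : k + 2 ≤ n := by have := Finset.mem_range.1 hk; omega
    rw [cf_rsmul, map_sub, cf_Y _ _ _ _ _ this, cf_Z _ _ _ _ _ this, if_neg (Ne.symm hkd)]; ring
  · intro h; exact absurd (Finset.mem_range.2 (by omega)) h

lemma cf_Zhat (n : ℕ) (v w : ℂ) (lam : ℝ) (d : ℕ) (hd : d + 2 ≤ n) :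
    cf n v w d (Zhat n lam) = cst n * (aSeq lam d * (2 * v * w)) := by
  rw [Zhat, map_sum, Finset.sum_eq_single d]
  · rw [cf_rsmul, cf_YZ _ _ _ _ _ hd, if_pos rfl]; ring
  · intro k hk hkd
    have : k + 2 ≤ n := by have := Finset.mem_range.1 hk; omega
    rw [cf_rsmul, cf_YZ _ _ _ _ _ this, if_neg (Ne.symm hkd)]; ring
  · intro h; exact absurd (Finset.mem_range.2 (by omega)) h

lemma cf_Xhat_zero (n : ℕ) (hn : 3 ≤ n) (v w : ℂ) (lam : ℝ) :
    cf n v w 0 (Xhat n lam) = cst n * (- lam * v ^ 2) := by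
  rw [Xhat, map_add, map_add, map_add, cf_rsmul, map_sub, cf_X n hn, cf_XX n hn,
    cf_Z _ _ _ _ _ (by omega), cf_Y _ _ _ _ _ (by omega), map_sum,
    if_neg (by omega), if_neg (by omega), if_neg (by omega)]
  rcases Nat.eq_or_lt_of_le hn with rfl | h
  · simp [aSeq]; ring
  · rw [if_neg (by omega), Finset.sum_eq_single 1]
    · rw [cf_rsmul, map_sub, cf_Y _ _ _ _ _ (by omega), cf_Z _ _ _ _ _ (by omega)]
      simp [aSeq]; ring
    · intro k hk hk1
      have := Finset.mem_Icc.1 hk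
      rw [cf_rsmul, map_sub, cf_Y _ _ _ _ _ (by omega), cf_Z _ _ _ _ _ (by omega),
        if_neg (by omega), if_neg (by omega)]
      ring
    · intro h'; exact absurd (Finset.mem_Icc.2 (by omega)) h'

lemma cf_Xhat_one (n : ℕ) (hn : 3 ≤ n) (w : ℂ) (lam : ℝ) :
    cf n 0 w 1 (Xhat n lam) = cst n * (1 + w ^ 2) := by
  rw [Xhat, map_add, map_add, map_add, cf_rsmul, map_sub, cf_X n hn, cf_XX n hn,
    cf_Z _ _ _ _ _ (by omega), cf_Y _ _ _ _ _ (by omega), map_sum,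
    if_pos rfl, if_neg (by omega), Finset.sum_eq_zero]
  · ring
  · intro k hk
    have := Finset.mem_Icc.1 hk
    rw [cf_rsmul, map_sub, cf_Y _ _ _ _ _ (by omega), cf_Z _ _ _ _ _ (by omega),
        if_neg (by omega : ¬ 1 = k + 1)]
    ring


/-- For every `n ≥ 3`, the subspaces `I_λ̄₁` and `I_λ̄₂` associated
with two distinct real roots of `a_{n-1}` intersect trivially. -/
theorem stmt15 (n : ℕ) (hn : 3 ≤ n) (lam1 lam2 : ℝ)
    (h1 : aSeq lam1 (n - 1) = 0) (h2 : aSeq lam2 (n - 1) = 0) (hne : lam1 ≠ lam2) :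
    Ideal n lam1 ⊓ Ideal n lam2 = ⊥ := by
  rw [Submodule.eq_bot_iff]
  rintro A ⟨hA1, hA2⟩
  have hc := cst_ne n hn
  obtain ⟨a, b, c, rfl⟩ := Submodule.mem_span_triple.1 hA1
  obtain ⟨a', b', c', hE⟩ := Submodule.mem_span_triple.1 hA2
  have key0 : ∀ v w : ℂ, (a' : ℂ) * (- lam2 * v ^ 2) + b' * (v ^ 2 - w ^ 2) + c' * (2 * v * w)
      = a * (- lam1 * v ^ 2) + b * (v ^ 2 - w ^ 2) + c * (2 * v * w) := by
    intro v w
    have := congrArg (cf n v w 0) hE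
    simp only [map_add, cf_rsmul, cf_Xhat_zero n hn, cf_Yhat n v w _ 0 (by omega),
      cf_Zhat n v w _ 0 (by omega), aSeq, Complex.ofReal_one] at this
    apply mul_left_cancel₀ hc
    linear_combination this
  have key1 : ∀ w : ℂ, (a' : ℂ) * (1 + w ^ 2) - b' * lam2 * w ^ 2
      = a * (1 + w ^ 2) - b * lam1 * w ^ 2 := by
    intro w
    have := congrArg (cf n 0 w 1) hE
    simp only [map_add, cf_rsmul, cf_Xhat_one n hn, cf_Yhat n 0 w _ 1 (by omega),
      cf_Zhat n 0 w _ 1 (by omega), aSeq] at this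
    apply mul_left_cancel₀ hc
    linear_combination this
  have hl : (lam1 : ℂ) - lam2 ≠ 0 := by
    rw [sub_ne_zero]; exact_mod_cast hne
  have ea : (a' : ℂ) = a := by linear_combination key1 0
  have eb : (b' : ℂ) = b := by linear_combination -key0 0 1
  have hb : (b : ℂ) = 0 := by
    apply (mul_eq_zero.1 _).resolve_right hl
    linear_combination key1 1 - 2 * ea + lam2 * eb
  have ha : (a : ℂ) = 0 := by
    apply (mul_eq_zero.1 _).resolve_right hl
    linear_combination key0 1 0 + lam2 * ea - eb
  have ha' : a = 0 := by exact_mod_cast ha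
  have hb' : b = 0 := by exact_mod_cast hb
  have ea' : a' = 0 := by rw [ha] at ea; exact_mod_cast ea
  have eb' : b' = 0 := by rw [hb] at eb; exact_mod_cast eb
  subst ha' hb' ea' eb'
  have ec : (c' : ℂ) = c := by
    have := key0 1 1
    simp only [Complex.ofReal_zero] at this
    linear_combination this / 2
  have hcz : (c : ℂ) = 0 := by
    apply (mul_eq_zero.1 _).resolve_right hl
    have := congrArg (cf n 1 1 1) hE
    simp only [map_add, cf_rsmul, cf_Zhat n 1 1 _ 1 (by omega), aSeq, Complex.ofReal_zero,
      zero_mul, zero_add] at this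
    apply mul_left_cancel₀ hc
    linear_combination -this / 2 + cst n * lam2 * ec
  have hcz' : c = 0 := by exact_mod_cast hcz
  subst hcz'
  simp

end
end Ising
end
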